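/- Let G be a finite simple graph with vertex set V = {1,…,n}, edge set E, and stability number α(G), and let r ≥ 1. Then there exist polynomials A, (Q_i)_{i∈V}, (Q_{ij})_{{i,j}∈E} in ℂ[x_1,…,x_n] satisfying the identity 1 = A·(−(α(G)+r) + Σ_{i=1}^n x_i) + Σ_{i∈V} Q_i·(x_i² − x_i) + Σ_{{i,j}∈E} Q_{ij}·x_i·x_j with max{deg A, deg Q_i, deg Q_{ij}} = α(G); that is, a Nullstellensatz certificate of degree α(G) for the non-existence of a stable set of size α(G)+r exists. -/

import Mathlib

open Finset MvPolynomial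

/-- The edge set of `G`, as ordered pairs `(i, j)` with `i < j`. -/
def edgePairs {n : ℕ} (G : SimpleGraph (Fin n)) [DecidableRel G.Adj] :
    Finset (Fin n × Fin n) :=
  Finset.univ.filter fun p => p.1 < p.2 ∧ G.Adj p.1 p.2

/-- A finset of vertices is stable (independent) if no two of its members are adjacent. -/
def IsStableSet {n : ℕ} (G : SimpleGraph (Fin n)) (S : Finset (Fin n)) : Prop :=
  ∀ i ∈ S, ∀ j ∈ S, ¬ G.Adj i j

/-- The stability number `α(G)`: the maximum size of a stable set of `G`. -/
def stabilityNumber {n : ℕ} (G : SimpleGraph (Fin n)) [DecidableRel G.Adj] : ℕ :=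
  (Finset.univ.powerset.filter fun S => ∀ i ∈ S, ∀ j ∈ S, ¬ G.Adj i j).sup Finset.card

/-- The Nullstellensatz certificate identity
`1 = A(−(α(G)+r) + Σ x_i) + Σ_i Q_i (x_i² − x_i) + Σ_{{i,j}∈E} Q_{ij} x_i x_j`
for the non-existence of a stable set of size `α(G) + r`. -/
def IsStableCert {n : ℕ} (G : SimpleGraph (Fin n)) [DecidableRel G.Adj] (r : ℕ)
    (A : MvPolynomial (Fin n) ℂ) (Q : Fin n → MvPolynomial (Fin n) ℂ)
    (Qe : Fin n × Fin n → MvPolynomial (Fin n) ℂ) : Prop :=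
  (1 : MvPolynomial (Fin n) ℂ) =
    A * ((∑ i : Fin n, X i) - C ((stabilityNumber G + r : ℕ) : ℂ)) +
    (∑ i : Fin n, Q i * (X i ^ 2 - X i)) +
    ∑ p ∈ edgePairs G, Qe p * (X p.1 * X p.2)

/-- The degree of a certificate: `max{deg A, deg Q_i, deg Q_{ij}}` (total degrees). -/
def stableCertDeg {n : ℕ} (G : SimpleGraph (Fin n)) [DecidableRel G.Adj]
    (A : MvPolynomial (Fin n) ℂ) (Q : Fin n → MvPolynomial (Fin n) ℂ)
    (Qe : Fin n × Fin n → MvPolynomial (Fin n) ℂ) : ℕ :=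
  max A.totalDegree
    (max (Finset.univ.sup fun i => (Q i).totalDegree)
      ((edgePairs G).sup fun p => (Qe p).totalDegree))

/-- A certificate is reduced when every monomial of `A` is square-free and its support
is a stable set of `G`. -/
def IsReducedCoeff {n : ℕ} (G : SimpleGraph (Fin n)) (A : MvPolynomial (Fin n) ℂ) : Prop :=
  ∀ m ∈ A.support, (∀ i : Fin n, m i ≤ 1) ∧ IsStableSet G m.support

/-- The square-free exponent vector `∏_{v ∈ S} x_v` associated with a finset `S`. -/
noncomputable def expOf {n : ℕ} (S : Finset (Fin n)) : Fin n →₀ ℕ :=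
  ∑ v ∈ S, Finsupp.single v 1

/-- The stable sets of `G`, as a finset of finsets. -/
def stableSets {n : ℕ} (G : SimpleGraph (Fin n)) [DecidableRel G.Adj] :
    Finset (Finset (Fin n)) :=
  Finset.univ.powerset.filter fun S => ∀ i ∈ S, ∀ j ∈ S, ¬ G.Adj i j

theorem mem_stableSets {n : ℕ} {G : SimpleGraph (Fin n)} [DecidableRel G.Adj]
    {S : Finset (Fin n)} : S ∈ stableSets G ↔ ∀ i ∈ S, ∀ j ∈ S, ¬ G.Adj i j := by
  simp [stableSets]

theorem card_le_stabilityNumber {n : ℕ} {G : SimpleGraph (Fin n)} [DecidableRel G.Adj]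
    {S : Finset (Fin n)} (hS : S ∈ stableSets G) : S.card ≤ stabilityNumber G :=
  Finset.le_sup (f := Finset.card) hS

theorem exists_card_eq_stabilityNumber {n : ℕ} (G : SimpleGraph (Fin n))
    [DecidableRel G.Adj] : ∃ S ∈ stableSets G, S.card = stabilityNumber G := by
  obtain ⟨S, hS, h⟩ := Finset.exists_mem_eq_sup (stableSets G)
    ⟨∅, mem_stableSets.2 (by simp)⟩ Finset.card
  exact ⟨S, hS, h.symm⟩

/-- The square-free monomial `∏_{v ∈ S} x_v`. -/
noncomputable def sqfreeMonomial {n : ℕ} (S : Finset (Fin n)) : MvPolynomial (Fin n) ℂ :=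
  ∏ v ∈ S, X v

theorem sqfreeMonomial_eq_monomial {n : ℕ} (S : Finset (Fin n)) :
    sqfreeMonomial S = monomial (expOf S) 1 := by
  simp [sqfreeMonomial, expOf, X, monomial_sum_one]

theorem expOf_injective {n : ℕ} : Function.Injective (expOf (n := n)) := by
  intro S T h
  ext v
  have := DFunLike.congr_fun h v
  simp only [expOf, Finsupp.finsetSum_apply, Finsupp.single_apply, Finset.sum_ite_eq'] at this
  split_ifs at this <;> simp_all

theorem totalDegree_sqfreeMonomial_le {n : ℕ} (S : Finset (Fin n)) :
    (sqfreeMonomial S).totalDegree ≤ S.card := by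
  refine (totalDegree_finsetProd _ _).trans ?_
  simp

theorem X_mul_sqfreeMonomial_erase {n : ℕ} {S : Finset (Fin n)} {i : Fin n} (hi : i ∈ S) :
    X i * sqfreeMonomial (S.erase i) = sqfreeMonomial S :=
  Finset.mul_prod_erase S _ hi

/-- The combinations of the polynomials `x_i² − x_i` and `x_i x_j`, `{i,j} ∈ E`, with
coefficients of total degree at most `d`. -/
noncomputable def boundedCombinations {n : ℕ} (G : SimpleGraph (Fin n)) [DecidableRel G.Adj]
    (d : ℕ) : Submodule ℂ (MvPolynomial (Fin n) ℂ) where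
  carrier := {f | ∃ (Q : Fin n → MvPolynomial (Fin n) ℂ)
    (Qe : Fin n × Fin n → MvPolynomial (Fin n) ℂ),
    (∀ i, (Q i).totalDegree ≤ d) ∧ (∀ p, (Qe p).totalDegree ≤ d) ∧
    f = (∑ i : Fin n, Q i * (X i ^ 2 - X i)) + ∑ p ∈ edgePairs G, Qe p * (X p.1 * X p.2)}
  zero_mem' := ⟨0, 0, by simp, by simp, by simp⟩
  add_mem' := by
    rintro f g ⟨Q, Qe, h, he, rfl⟩ ⟨R, Re, k, ke, rfl⟩
    refine ⟨Q + R, Qe + Re,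
      fun i => (totalDegree_add _ _).trans (max_le (h i) (k i)),
      fun p => (totalDegree_add _ _).trans (max_le (he p) (ke p)), ?_⟩
    simp only [Pi.add_apply, add_mul, Finset.sum_add_distrib]
    ring
  smul_mem' := by
    rintro c f ⟨Q, Qe, h, he, rfl⟩
    refine ⟨c • Q, c • Qe, fun i => (totalDegree_smul_le _ _).trans (h i),
      fun p => (totalDegree_smul_le _ _).trans (he p), ?_⟩
    simp only [Pi.smul_apply, smul_add, Finset.smul_sum, smul_mul_assoc]

theorem mul_sq_sub_mem_boundedCombinations {n : ℕ} (G : SimpleGraph (Fin n))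
    [DecidableRel G.Adj] {d : ℕ} {f : MvPolynomial (Fin n) ℂ} (hf : f.totalDegree ≤ d)
    (i : Fin n) : f * (X i ^ 2 - X i) ∈ boundedCombinations G d := by
  refine ⟨Pi.single i f, 0, fun j => ?_, by simp, ?_⟩
  · by_cases h : j = i
    · subst h; simpa
    · simp [h]
  · rw [Finset.sum_eq_single i (fun j _ h => by simp [h]) (by simp)]
    simp

theorem mul_edge_mem_boundedCombinations {n : ℕ} {G : SimpleGraph (Fin n)}
    [DecidableRel G.Adj] {d : ℕ} {f : MvPolynomial (Fin n) ℂ} (hf : f.totalDegree ≤ d)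
    {i j : Fin n} (hij : G.Adj i j) : f * (X i * X j) ∈ boundedCombinations G d := by
  wlog hlt : i < j generalizing i j
  · rw [mul_comm (X i)]
    exact this hij.symm (lt_of_le_of_ne (not_lt.1 hlt) hij.ne')
  refine ⟨0, Pi.single (i, j) f, by simp, fun p => ?_, ?_⟩
  · by_cases h : p = (i, j)
    · subst h; simpa
    · simp [h]
  · rw [Finset.sum_eq_single (i, j) (fun p _ h => by simp [h])
      (fun h => absurd (by simp [edgePairs, hlt, hij]) h)]
    simp

/-- Modulo `boundedCombinations`, the product of a variable with the monomial of a stable set `S`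
is the monomial of `insert i S`, or zero if that set is not stable. -/
theorem X_mul_sqfreeMonomial_sub_mem {n : ℕ} {G : SimpleGraph (Fin n)} [DecidableRel G.Adj]
    {d : ℕ} {S : Finset (Fin n)} (hS : S ∈ stableSets G) (hd : S.card ≤ d) (i : Fin n) :
    sqfreeMonomial S * X i -
      (if insert i S ∈ stableSets G then sqfreeMonomial (insert i S) else 0) ∈
      boundedCombinations G d := by
  have hdeg (j : Fin n) : (sqfreeMonomial (S.erase j)).totalDegree ≤ d :=
    (totalDegree_sqfreeMonomial_le _).trans ((Finset.card_le_card (S.erase_subset j)).trans hd)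
  by_cases hi : i ∈ S
  · rw [Finset.insert_eq_of_mem hi, if_pos hS, ← X_mul_sqfreeMonomial_erase hi]
    convert mul_sq_sub_mem_boundedCombinations G (hdeg i) i using 1
    ring
  · split_ifs with h
    · have : sqfreeMonomial (insert i S) = X i * sqfreeMonomial S := Finset.prod_insert hi
      rw [this, mul_comm, sub_self]
      exact zero_mem _
    · obtain ⟨j, hj, hij⟩ : ∃ j ∈ S, G.Adj i j := by
        by_contra! hc
        refine h (mem_stableSets.2 ?_)
        rw [mem_stableSets] at hS
        simp only [Finset.forall_mem_insert]
        exact ⟨⟨G.irrefl, hc⟩, fun j hj => ⟨fun hji => hc j hj hji.symm, hS j hj⟩⟩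
      rw [sub_zero, ← X_mul_sqfreeMonomial_erase hj]
      convert mul_edge_mem_boundedCombinations (hdeg j) hij using 1
      ring

/-- The number `k! / (c (c - 1) ⋯ (c - k))`. -/
noncomputable def certCoeff (c : ℂ) (k : ℕ) : ℂ :=
  k.factorial / ∏ j ∈ Finset.range (k + 1), (c - j)

theorem certCoeff_ne_zero {c : ℂ} {k : ℕ} (h : ∀ j ≤ k, c - j ≠ 0) : certCoeff c k ≠ 0 :=
  div_ne_zero (by exact_mod_cast k.factorial_ne_zero)
    (Finset.prod_ne_zero_iff.2 fun j hj => h j (by simpa [Nat.lt_succ_iff] using hj))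

theorem certCoeff_zero_mul {c : ℂ} (h : c ≠ 0) : certCoeff c 0 * c = 1 := by
  simp [certCoeff, h]

theorem certCoeff_succ_mul {c : ℂ} {k : ℕ} (h : c - (k + 1 : ℕ) ≠ 0) :
    certCoeff c (k + 1) * (c - (k + 1 : ℕ)) = (k + 1 : ℕ) * certCoeff c k := by
  rw [certCoeff, certCoeff, Finset.prod_range_succ _ (k + 1), Nat.factorial_succ,
    div_mul_eq_mul_div, mul_div_mul_right _ _ h, Nat.cast_mul, mul_div_assoc]

/-- Counting pairs `(S, i)` of a stable set and a vertex by the stable set `insert i S`. -/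
theorem sum_stableSets_insert {n : ℕ} (G : SimpleGraph (Fin n)) [DecidableRel G.Adj]
    (a : ℕ → ℂ) :
    ∑ S ∈ stableSets G, ∑ i : Fin n, a S.card •
        (if insert i S ∈ stableSets G then sqfreeMonomial (insert i S) else 0) =
      ∑ T ∈ stableSets G, (T.card * (a T.card + a (T.card - 1))) • sqfreeMonomial T := by
  have hsplit (S : Finset (Fin n)) (i : Fin n) : a S.card •
        (if insert i S ∈ stableSets G then sqfreeMonomial (insert i S) else 0) =
      (if i ∈ S then a S.card •
        (if insert i S ∈ stableSets G then sqfreeMonomial (insert i S) else 0) else 0) +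
      (if i ∉ S ∧ insert i S ∈ stableSets G then
        a S.card • sqfreeMonomial (insert i S) else 0) := by
    by_cases hi : i ∈ S <;> simp [hi]
  rw [Finset.sum_congr rfl fun S _ => Finset.sum_congr rfl fun i _ => hsplit S i]
  simp_rw [Finset.sum_add_distrib, mul_add, add_smul, Finset.sum_add_distrib]
  congr 1
  · refine Finset.sum_congr rfl fun S hS => ?_
    have (i : Fin n) : (if i ∈ S then a S.card •
        (if insert i S ∈ stableSets G then sqfreeMonomial (insert i S) else 0) else 0) =
        if i ∈ S then a S.card • sqfreeMonomial S else 0 := by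
      split_ifs <;> simp_all
    simp_rw [this]
    rw [Finset.sum_ite_mem, Finset.univ_inter, Finset.sum_const, mul_smul, Nat.cast_smul_eq_nsmul]
  · have hR : ∑ T ∈ stableSets G, ((T.card : ℂ) * a (T.card - 1)) • sqfreeMonomial T =
        ∑ T ∈ stableSets G, ∑ i ∈ T, a (T.card - 1) • sqfreeMonomial T := by
      refine Finset.sum_congr rfl fun T hT => ?_
      rw [Finset.sum_const, mul_smul, Nat.cast_smul_eq_nsmul]
    simp_rw [hR, ← Finset.sum_filter]
    rw [Finset.sum_sigma', Finset.sum_sigma']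
    refine Finset.sum_bij' (fun p _ => ⟨insert p.2 p.1, p.2⟩) (fun p _ => ⟨p.1.erase p.2, p.2⟩)
      ?_ ?_ ?_ ?_ ?_
    · rintro ⟨S, i⟩ h
      simp_all
    · rintro ⟨T, i⟩ h
      simp only [Finset.mem_sigma, Finset.mem_filter, Finset.mem_univ, true_and] at h ⊢
      refine ⟨mem_stableSets.2 fun x hx y hy => ?_, by simp, by
        rw [Finset.insert_erase h.2]; exact h.1⟩
      exact mem_stableSets.1 h.1 x (Finset.mem_of_mem_erase hx) y (Finset.mem_of_mem_erase hy)
    · rintro ⟨S, i⟩ h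
      simp_all
    · rintro ⟨T, i⟩ h
      simp_all
    · rintro ⟨S, i⟩ h
      simp_all

/-- The reduced coefficient polynomial `-∑_S |S|! / (c (c - 1) ⋯ (c - |S|)) x^S`, summed over the
stable sets `S`. -/
noncomputable def certPoly {n : ℕ} (G : SimpleGraph (Fin n)) [DecidableRel G.Adj] (c : ℂ) :
    MvPolynomial (Fin n) ℂ :=
  -∑ S ∈ stableSets G, certCoeff c S.card • sqfreeMonomial S

theorem coeff_certPoly {n : ℕ} {G : SimpleGraph (Fin n)} [DecidableRel G.Adj] (c : ℂ)
    {S : Finset (Fin n)} (hS : S ∈ stableSets G) :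
    coeff (expOf S) (certPoly G c) = -certCoeff c S.card := by
  simp [certPoly, sqfreeMonomial_eq_monomial, coeff_sum, coeff_monomial,
    expOf_injective.eq_iff, hS]

theorem totalDegree_certPoly {n : ℕ} {G : SimpleGraph (Fin n)} [DecidableRel G.Adj] {c : ℂ}
    (hc : ∀ k ≤ stabilityNumber G, c - k ≠ 0) :
    (certPoly G c).totalDegree = stabilityNumber G := by
  apply le_antisymm
  · rw [certPoly, totalDegree_neg]
    exact totalDegree_finsetSum_le fun S hS => (totalDegree_smul_le _ _).trans
      ((totalDegree_sqfreeMonomial_le S).trans (card_le_stabilityNumber hS))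
  · obtain ⟨S, hS, hcard⟩ := exists_card_eq_stabilityNumber G
    have hmem : expOf S ∈ (certPoly G c).support := by
      rw [mem_support_iff, coeff_certPoly c hS, neg_ne_zero]
      exact certCoeff_ne_zero fun j hj => hc j (hj.trans hcard.le)
    refine le_trans ?_ (le_totalDegree hmem)
    change _ ≤ (expOf S).degree
    simp [← hcard, expOf]

theorem one_sub_certPoly_mul_mem {n : ℕ} {G : SimpleGraph (Fin n)} [DecidableRel G.Adj] {c : ℂ}
    (hc : ∀ k ≤ stabilityNumber G, c - k ≠ 0) :
    1 - certPoly G c * ((∑ i : Fin n, X i) - C c) ∈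
      boundedCombinations G (stabilityNumber G) := by
  have hrel : (∑ S ∈ stableSets G,
      (S.card * (certCoeff c S.card + certCoeff c (S.card - 1)) - certCoeff c S.card * c) •
        sqfreeMonomial S) = -1 := by
    rw [Finset.sum_eq_single ∅]
    · have h0 : c ≠ 0 := by simpa using hc 0 (Nat.zero_le _)
      simp [certCoeff_zero_mul h0, sqfreeMonomial]
    · intro S hS hne
      obtain ⟨k, hk⟩ : ∃ k, S.card = k + 1 :=
        Nat.exists_eq_succ_of_ne_zero (Finset.card_ne_zero_of_mem
          (Finset.nonempty_iff_ne_empty.2 hne).choose_spec)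
      have := certCoeff_succ_mul (hc (k + 1) (hk ▸ card_le_stabilityNumber hS))
      rw [hk, Nat.add_sub_cancel]
      convert zero_smul ℂ _
      linear_combination -this
    · exact fun h => absurd (mem_stableSets.2 (by simp)) h
  have hmem : ∑ S ∈ stableSets G, ∑ i : Fin n, certCoeff c S.card • (sqfreeMonomial S * X i -
      (if insert i S ∈ stableSets G then sqfreeMonomial (insert i S) else 0)) ∈
      boundedCombinations G (stabilityNumber G) :=
    Submodule.sum_mem _ fun S hS => Submodule.sum_mem _ fun i _ => Submodule.smul_mem _ _
      (X_mul_sqfreeMonomial_sub_mem hS (card_le_stabilityNumber hS) i)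
  convert hmem using 1
  simp_rw [smul_sub, Finset.sum_sub_distrib]
  rw [sum_stableSets_insert]
  simp_rw [sub_smul, Finset.sum_sub_distrib] at hrel
  rw [sub_eq_iff_eq_add.1 hrel, certPoly, neg_mul, mul_sub, Finset.sum_mul, Finset.sum_mul]
  simp_rw [← Finset.smul_sum, ← Finset.mul_sum, smul_mul_assoc, mul_comm _ (C c), ← smul_eq_C_mul,
    smul_smul]
  ring

/-- For every graph `G` and every `r ≥ 1` there exists a Nullstellensatz
certificate `1 = A(−(α(G)+r) + Σ x_i) + Σ Q_i (x_i² − x_i) + Σ Q_{ij} x_i x_j` of degree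
exactly `α(G)` for the non-existence of a stable set of size `α(G) + r`. -/
theorem exists_stable_certificate_of_degree_alpha (n : ℕ) (G : SimpleGraph (Fin n))
    [DecidableRel G.Adj] (r : ℕ) (hr : 1 ≤ r) :
    ∃ (A : MvPolynomial (Fin n) ℂ) (Q : Fin n → MvPolynomial (Fin n) ℂ)
      (Qe : Fin n × Fin n → MvPolynomial (Fin n) ℂ),
      IsStableCert G r A Q Qe ∧ stableCertDeg G A Q Qe = stabilityNumber G := by
  have hc : ∀ k ≤ stabilityNumber G, ((stabilityNumber G + r : ℕ) : ℂ) - k ≠ 0 := by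
    intro k hk h
    have : stabilityNumber G + r = k := by exact_mod_cast sub_eq_zero.1 h
    omega
  obtain ⟨Q, Qe, hQ, hQe, h⟩ := one_sub_certPoly_mul_mem hc
  refine ⟨certPoly G (stabilityNumber G + r : ℕ), Q, Qe, ?_, ?_⟩
  · rw [IsStableCert, add_assoc, ← h]
    ring
  · rw [stableCertDeg, totalDegree_certPoly hc]
    exact max_eq_left (max_le (Finset.sup_le fun i _ => hQ i) (Finset.sup_le fun p _ => hQe p))
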